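/- (Lemma 4.4, conditional expectation bound at stopping times) Let (Ω,ℱ,ℙ;(ℱ_t)_{t≥0}) be a filtered probability space and let (X_t)_{t≥0} be a real-valued adapted stochastic process with right-continuous sample paths. Suppose there exist Y∈L¹(Ω) and a constant A > 0 such that for every t ≥ 0, |X_t| ≤ Y ℙ-a.s. and 𝔼(X_t | ℱ_t) ≤ A ℙ-a.s. Then for every a.s.-finite stopping time τ, one has 𝔼(X_τ | ℱ_τ) ≤ A ℙ-a.s., where ℱ_τ is the σ-algebra of events prior to τ. -/

import Mathlib

open MeasureTheory Set
open scoped NNReal ENNReal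

/-- **Lemma 4.4 (conditional expectation bound at stopping times).** -/
theorem condexp_bound_at_stopping_time
    {Ω : Type*} {m0 : MeasurableSpace Ω}
    (μ : Measure Ω) [IsProbabilityMeasure μ]
    (F : Filtration ℝ≥0 m0)
    (X : ℝ≥0 → Ω → ℝ)
    (hadapted : StronglyAdapted F X)
    (hrc : ∀ ω, ∀ t : ℝ≥0, ContinuousWithinAt (fun s => X s ω) (Ici t) t)
    (Y : Ω → ℝ) (hY : Integrable Y μ)
    (A : ℝ) (hA : 0 < A)
    (hdom : ∀ t : ℝ≥0, ∀ᵐ ω ∂μ, |X t ω| ≤ Y ω)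
    (hbound : ∀ t : ℝ≥0, ∀ᵐ ω ∂μ, (μ[X t | F t]) ω ≤ A)
    (τ : Ω → ℝ≥0) (hτ : IsStoppingTime F (fun ω => (τ ω : WithTop ℝ≥0))) :
    ∀ᵐ ω ∂μ, (μ[fun ω' => X (τ ω') ω' | hτ.measurableSpace]) ω ≤ A := by
  have h1 : ∀ t : ℝ≥0, ∀ᵐ ω ∂μ, X t ω ≤ A := by
    intro t
    have hi : Integrable (X t) μ :=
      hY.mono' ((hadapted t).mono (F.le t)).aestronglyMeasurable (hdom t)
    have h := hbound t
    rwa [condExp_of_stronglyMeasurable (F.le t) (hadapted t) hi] at h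
  obtain ⟨D, hDc, hDd⟩ := TopologicalSpace.exists_countable_dense ℝ≥0
  have h2 : ∀ᵐ ω ∂μ, ∀ t ∈ D, X t ω ≤ A := (ae_ball_iff hDc).2 fun t _ => h1 t
  have h3 : ∀ᵐ ω ∂μ, X (τ ω) ω ≤ A := by
    filter_upwards [h2] with ω hω
    by_contra! hlt
    have hev := (hrc ω (τ ω)).eventually (lt_mem_nhds hlt)
    obtain ⟨u, hu, hsub⟩ := (mem_nhdsGE_iff_exists_Ico_subset).1 hev
    obtain ⟨s, hsD, hs⟩ := hDd.exists_between hu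
    exact absurd (hω s hsD) (not_le.2 (hsub ⟨hs.1.le, hs.2⟩))
  by_cases hi : Integrable (fun ω' => X (τ ω') ω') μ
  · have h4 := condExp_mono (m := hτ.measurableSpace) hi (integrable_const A) h3
    by_cases hm : hτ.measurableSpace ≤ m0
    · rw [condExp_const hm] at h4
      exact h4
    · rw [condExp_of_not_le hm]
      exact Filter.Eventually.of_forall fun _ => hA.le
  · rw [condExp_of_not_integrable hi]
    exact Filter.Eventually.of_forall fun _ => hA.le
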